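/- There exist fields ℚ ⊆ K ⊆ L ⊆ \overline{ℚ} such that K/ℚ is an infinite algebraic extension, K does not satisfy the Bogomolov property (B), the extension L/K is infinite, and L/K is Bogomolov. -/

import Mathlib

open NumberField IntermediateField
open scoped Classical

noncomputable section

namespace RelBogomolov

/-- The "denominator ideal" of an element `x` of a field `K`: the ideal of integers `a` of `K`
such that `a * x` is an algebraic integer.  For a number field `K`, the logarithm of its absolute
norm is the finite (non-archimedean) part `∑_{v finite} log max (1, |x|_v)` of the Weil height. -/
def denomIdeal (K : Type*) [Field K] (x : K) : Ideal (𝓞 K) where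
  carrier := {a | IsIntegral ℤ ((a : K) * x)}
  add_mem' := by
    intro a b ha hb
    have := ha.add hb
    simpa [add_mul] using this
  zero_mem' := by
    simpa using isIntegral_zero
  smul_mem' := by
    intro c a ha
    have hc : IsIntegral ℤ (c : K) := RingOfIntegers.isIntegral_coe c
    simpa [smul_eq_mul, mul_assoc] using hc.mul ha

/-- The absolute logarithmic Weil height of an element of a number field `K`:
`h(x) = (1/[K:ℚ]) (∑_{v archimedean} [K_v : ℚ_v] log max (1, |x|_v)
          + ∑_{v finite} [K_v : ℚ_v] log max (1, |x|_v))`,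
where the finite part is expressed as the log of the absolute norm of the denominator ideal. -/
def nfHeight (K : Type*) [Field K] [NumberField K] (x : K) : ℝ :=
  (Module.finrank ℚ K : ℝ)⁻¹ *
    ((∑ w : InfinitePlace K, (w.mult : ℝ) * Real.log (max 1 (w x))) +
      Real.log (Ideal.absNorm (denomIdeal K x)))

/-- The absolute logarithmic Weil height of a complex number that is algebraic over `ℚ`,
computed in the number field `ℚ(x)` (junk value `0` for transcendental numbers). -/
def algHeight (x : ℂ) : ℝ :=
  if hx : IsIntegral ℚ x then
    letI : FiniteDimensional ℚ ℚ⟮x⟯ := adjoin.finiteDimensional hx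
    haveI : CharZero ℚ⟮x⟯ := charZero_of_injective_algebraMap (algebraMap ℚ ℚ⟮x⟯).injective
    haveI : NumberField ℚ⟮x⟯ := ⟨⟩
    nfHeight ℚ⟮x⟯ (AdjoinSimple.gen ℚ x)
  else 0

/-- The multiplicative Weil height `H(x) = exp h(x)`. -/
def mulHeight (x : ℂ) : ℝ := Real.exp (algHeight x)

/-- A fixed algebraic closure of `ℚ`: the field of algebraic numbers inside `ℂ`. -/
def Qbar : IntermediateField ℚ ℂ := _root_.algebraicClosure ℚ ℂ

/-- A subfield `K` of `ℚ̄` has the Bogomolov property (B) if there is `ε > 0` such that no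
nonzero element of `K` has height strictly between `0` and `ε`. -/
def HasBogomolovProperty (K : IntermediateField ℚ ℂ) : Prop :=
  ∃ ε : ℝ, 0 < ε ∧ ∀ x : ℂ, x ∈ K → x ≠ 0 → ¬(0 < algHeight x ∧ algHeight x < ε)

/-- The extension `L/K` is Bogomolov if there is `ε > 0` such that every nonzero `x ∈ L`
with `0 < h(x) < ε` lies in `K`. -/
def IsBogomolovExtension (K L : IntermediateField ℚ ℂ) : Prop :=
  ∃ ε : ℝ, 0 < ε ∧ ∀ x : ℂ, x ∈ L → x ≠ 0 → 0 < algHeight x → algHeight x < ε → x ∈ K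

/-- `δ(M)`: the number of archimedean places of `M` (junk value `0` in the infinite case). -/
def archPlaces (M : IntermediateField ℚ ℂ) : ℕ :=
  if h : FiniteDimensional ℚ ↥M then
    letI := h
    haveI : CharZero ↥M := charZero_of_injective_algebraMap (algebraMap ℚ ↥M).injective
    haveI : NumberField ↥M := ⟨⟩
    Fintype.card (InfinitePlace ↥M)
  else 0

/-- The absolute norm `N_{F/ℚ}` of an ideal of the ring of integers of a subfield `F ⊆ ℚ̄`
(junk value `0` in the infinite case). -/
def idealNorm {F : IntermediateField ℚ ℂ} (I : Ideal (𝓞 ↥F)) : ℕ :=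
  if h : FiniteDimensional ℚ ↥F then
    letI := h
    haveI : CharZero ↥F := charZero_of_injective_algebraMap (algebraMap ℚ ↥F).injective
    haveI : NumberField ↥F := ⟨⟩
    Ideal.absNorm I
  else 0

/-- The relative discriminant ideal `D_{F'/F}` of an extension of number fields, defined as
the ideal of `𝓞 F` generated by the discriminants of all `[F':F]`-tuples of integers of `F'`. -/
def relDiscrNF (F F' : Type*) [Field F] [Field F'] [Algebra F F'] : Ideal (𝓞 F) :=
  Ideal.span {d : 𝓞 F | ∃ x : Fin (Module.finrank F F') → 𝓞 F', d = Algebra.discr (𝓞 F) x}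

/-- The relative discriminant ideal `D_{C/F}` for subfields `F ≤ C` of `ℚ̄`
(junk value `⊥` if `F ≰ C`). -/
def relDiscr (F C : IntermediateField ℚ ℂ) : Ideal (𝓞 ↥F) :=
  if h : F ≤ C then
    letI : Algebra ↥F ↥C := (IntermediateField.inclusion h).toAlgebra
    relDiscrNF ↥F ↥C
  else ⊥

/-- The inclusion `𝓞 F →+* 𝓞 M` of rings of integers induced by an inclusion `F ≤ M` of
subfields of `ℚ̄`. -/
def intInclusion {F M : IntermediateField ℚ ℂ} (h : F ≤ M) : 𝓞 ↥F →+* 𝓞 ↥M :=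
  RingOfIntegers.mapRingHom (IntermediateField.inclusion h)

/-- `ρ(K/F)`: the least real number `ρ` such that every finite subextension `M` of `K/F` is
contained in a finite subextension `M'` of `K/F` with `δ(M')/[M':F] ≤ ρ`. -/
def rho (F K : IntermediateField ℚ ℂ) : ℝ :=
  sInf {r : ℝ | ∀ M : IntermediateField ℚ ℂ, F ≤ M → M ≤ K → FiniteDimensional ℚ ↥M →
    ∃ M' : IntermediateField ℚ ℂ, M ≤ M' ∧ M' ≤ K ∧ FiniteDimensional ℚ ↥M' ∧
      (archPlaces M' : ℝ) / (relfinrank F M' : ℝ) ≤ r}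

/-- The norm excess discriminant `E(K, C/F)`: the infimum over finite subextensions `M` of
`K/F` (with `e = [M:F]`, `s = [C:F]`) of
`N_{F/ℚ}(D_{C/F}^e / gcd(D_{C/F}^e, D_{M/F}^s))^{1/e}`; here the gcd of two ideals is their
sup, and the norm of the quotient ideal is the quotient of the norms. -/
def normExcess (K F C : IntermediateField ℚ ℂ) : ℝ :=
  sInf {r : ℝ | ∃ M : IntermediateField ℚ ℂ, F ≤ M ∧ M ≤ K ∧ FiniteDimensional ℚ ↥M ∧
    r = ((idealNorm ((relDiscr F C) ^ (relfinrank F M)) : ℝ) /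
          (idealNorm ((relDiscr F C) ^ (relfinrank F M) ⊔ (relDiscr F M) ^ (relfinrank F C)) : ℝ))
        ^ ((relfinrank F M : ℝ)⁻¹)}

/-- `a(𝔭)`: the greatest `k` such that `x^ℓ ≡ α (mod 𝔭^k)` has a solution `x ∈ 𝓞 F`. -/
def aExp (F : Type*) [Field F] (ℓ : ℕ) (α : 𝓞 F) (𝔭 : Ideal (𝓞 F)) : ℕ :=
  sSup {k : ℕ | ∃ x : 𝓞 F, x ^ ℓ - α ∈ 𝔭 ^ k}

end RelBogomolov

open RelBogomolov

namespace RelBogomolov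

section Height

variable {K₁ K₂ K : Type*} [Field K₁] [Field K₂] [Field K]

theorem sum_infinitePlace_eq_sum_embeddings [NumberField K] (g : ℝ → ℝ) (x : K) :
    ∑ w : InfinitePlace K, (w.mult : ℝ) * g (w x) = ∑ φ : K →+* ℂ, g ‖φ x‖ := by
  rw [← Finset.sum_fiberwise Finset.univ InfinitePlace.mk (fun φ : K →+* ℂ => g ‖φ x‖)]
  refine Finset.sum_congr rfl fun w _ => ?_
  rw [← InfinitePlace.card_filter_mk_eq w, ← nsmul_eq_mul, ← Finset.sum_const]
  refine Finset.sum_congr rfl fun φ hφ => ?_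
  rw [← (Finset.mem_filter.mp hφ).2, InfinitePlace.apply]

theorem card_embeddings_extending [NumberField K₁] [NumberField K₂] [Algebra K₁ K₂]
    (φ : K₁ →+* ℂ) :
    (Finset.univ.filter fun ψ : K₂ →+* ℂ => ψ.comp (algebraMap K₁ K₂) = φ).card =
      Module.finrank K₁ K₂ := by
  let := φ.toAlgebra
  rw [← AlgHom.card K₁ K₂ ℂ, ← Fintype.card_subtype]
  exact Fintype.card_congr
    { toFun := fun ψ => { ψ.1 with commutes' := fun r => RingHom.congr_fun ψ.2 r }
      invFun := fun ψ => ⟨ψ.toRingHom, RingHom.ext fun r => ψ.commutes r⟩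
      left_inv := fun _ => rfl
      right_inv := fun _ => rfl }

theorem sum_embeddings_algebraMap [NumberField K₁] [NumberField K₂] [Algebra K₁ K₂]
    (g : ℝ → ℝ) (x : K₁) :
    ∑ ψ : K₂ →+* ℂ, g ‖ψ (algebraMap K₁ K₂ x)‖ =
      Module.finrank K₁ K₂ * ∑ φ : K₁ →+* ℂ, g ‖φ x‖ := by
  rw [← Finset.sum_fiberwise Finset.univ
    (fun ψ : K₂ →+* ℂ => ψ.comp (algebraMap K₁ K₂)), Finset.mul_sum]
  refine Finset.sum_congr rfl fun φ _ => ?_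
  rw [← card_embeddings_extending (K₂ := K₂) φ, ← nsmul_eq_mul, ← Finset.sum_const]
  refine Finset.sum_congr rfl fun ψ hψ => ?_
  rw [← (Finset.mem_filter.mp hψ).2, RingHom.comp_apply]

theorem mem_denomIdeal {x : K} {a : 𝓞 K} :
    a ∈ denomIdeal K x ↔ IsIntegral ℤ ((a : K) * x) := Iff.rfl

theorem exists_nat_mul_isIntegral [NumberField K] (x : K) :
    ∃ m : ℕ, m ≠ 0 ∧ IsIntegral ℤ ((m : K) * x) := by
  obtain ⟨y, hy, h⟩ := ((IsFractionRing.isAlgebraic_iff ℤ ℚ K).mpr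
    (Algebra.IsAlgebraic.isAlgebraic x)).exists_integral_multiple
  refine ⟨y.natAbs, Int.natAbs_ne_zero.mpr hy, ?_⟩
  rw [zsmul_eq_mul] at h
  rcases Int.natAbs_eq y with e | e
  · rwa [e, Int.cast_natCast] at h
  · rw [e] at h
    simpa using h.neg

theorem denomIdeal_ne_bot [NumberField K] (x : K) : denomIdeal K x ≠ ⊥ := by
  obtain ⟨m, hm, h⟩ := exists_nat_mul_isIntegral x
  intro h0
  have : (m : 𝓞 K) ∈ denomIdeal K x := by simpa [mem_denomIdeal] using h
  rw [h0, Ideal.mem_bot] at this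
  exact hm (by exact_mod_cast this)

theorem absNorm_denomIdeal_pos [NumberField K] (x : K) :
    0 < Ideal.absNorm (denomIdeal K x) :=
  Nat.pos_of_ne_zero fun h => denomIdeal_ne_bot x (Ideal.absNorm_eq_zero_iff.mp h)

theorem absNorm_denomIdeal_algebraMap_le [NumberField K₁] [NumberField K₂] [Algebra K₁ K₂]
    (x : K₁) :
    Ideal.absNorm (denomIdeal K₂ (algebraMap K₁ K₂ x)) ≤
      Ideal.absNorm (denomIdeal K₁ x) ^ Module.finrank K₁ K₂ := by
  have hfin : Module.finrank (𝓞 K₁) (𝓞 K₂) = Module.finrank K₁ K₂ :=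
    (IsFractionRing.finrank_eq (𝓞 K₁) K₁ (𝓞 K₂) K₂).symm
  rw [← hfin, ← Ideal.absNorm_algebraMap]
  refine Nat.le_of_dvd ?_ (Ideal.absNorm_dvd_absNorm_of_le ?_)
  · rw [Ideal.absNorm_algebraMap]
    exact pow_pos (absNorm_denomIdeal_pos x) _
  · rw [Ideal.map_le_iff_le_comap]
    intro a ha
    rw [Ideal.mem_comap, mem_denomIdeal]
    have := (mem_denomIdeal.mp ha).map (algebraMap K₁ K₂).toIntAlgHom
    rwa [map_mul] at this

theorem nfHeight_algebraMap_le [NumberField K₁] [NumberField K₂] [Algebra K₁ K₂] (x : K₁) :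
    nfHeight K₂ (algebraMap K₁ K₂ x) ≤ nfHeight K₁ x := by
  have h1 := sum_embeddings_algebraMap (K₂ := K₂) (fun t => Real.log (max 1 t)) x
  have h2 : (0 : ℝ) < Module.finrank K₁ K₂ := by exact_mod_cast Module.finrank_pos
  have h3 : (0 : ℝ) < Module.finrank ℚ K₁ := by exact_mod_cast Module.finrank_pos
  have h4 : (Module.finrank ℚ K₂ : ℝ) = Module.finrank ℚ K₁ * Module.finrank K₁ K₂ := by
    exact_mod_cast (Module.finrank_mul_finrank ℚ K₁ K₂).symm
  have h5 : Real.log (Ideal.absNorm (denomIdeal K₂ (algebraMap K₁ K₂ x))) ≤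
      Module.finrank K₁ K₂ * Real.log (Ideal.absNorm (denomIdeal K₁ x)) := by
    rw [← Real.log_pow]
    refine Real.log_le_log (by exact_mod_cast absNorm_denomIdeal_pos _) ?_
    exact_mod_cast absNorm_denomIdeal_algebraMap_le x
  rw [nfHeight, nfHeight, sum_infinitePlace_eq_sum_embeddings (fun t => Real.log (max 1 t)),
    sum_infinitePlace_eq_sum_embeddings (fun t => Real.log (max 1 t)), h1, h4,
    inv_mul_le_iff₀ (by positivity)]
  calc _ ≤ _ := add_le_add_right h5 _
    _ = _ := by field_simp

theorem nfHeight_map_le [NumberField K₁] [NumberField K₂] (f : K₁ →+* K₂) (x : K₁) :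
    nfHeight K₂ (f x) ≤ nfHeight K₁ x :=
  letI := f.toAlgebra
  nfHeight_algebraMap_le x

theorem one_le_norm_mul_absNorm [NumberField K] {γ : K} (hγ : γ ≠ 0) {J : Ideal (𝓞 K)}
    (hJ0 : J ≠ ⊥) (hJ : J ≤ denomIdeal K γ) :
    1 ≤ |((Algebra.norm ℚ γ : ℚ) : ℝ)| * Ideal.absNorm J := by
  obtain ⟨m, hm, h_int⟩ := exists_nat_mul_isIntegral γ
  set g : 𝓞 K := ⟨(m : K) * γ, h_int⟩ with hg
  have hg0 : g ≠ 0 := by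
    intro h
    have : (m : K) * γ = 0 := congrArg (algebraMap (𝓞 K) K) h
    simp [hm, hγ] at this
  have hle : Ideal.span {g} * J ≤ Ideal.span {(m : 𝓞 K)} := by
    rw [Ideal.span_singleton_mul_le_iff]
    intro z hz
    rw [Ideal.mem_span_singleton]
    refine ⟨⟨(z : K) * γ, hJ hz⟩, ?_⟩
    apply RingOfIntegers.ext
    change (m : K) * γ * z = algebraMap (𝓞 K) K (m : 𝓞 K) * (z * γ)
    rw [map_natCast]
    ring
  have hN := Nat.le_of_dvd ?_ (Ideal.absNorm_dvd_absNorm_of_le hle)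
  · rw [map_mul, Ideal.absNorm_span_singleton, Ideal.absNorm_span_singleton] at hN
    have e (z : 𝓞 K) : ((Algebra.norm ℤ z).natAbs : ℝ) =
        |((Algebra.norm ℚ (z : K) : ℚ) : ℝ)| := by
      rw [← Algebra.coe_norm_int]
      simp [Nat.cast_natAbs]
    have hN' : (((Algebra.norm ℤ (m : 𝓞 K)).natAbs : ℕ) : ℝ) ≤
      ((Algebra.norm ℤ g).natAbs : ℝ) * Ideal.absNorm J := by exact_mod_cast hN
    rw [e, e] at hN'
    have hgm : (g : K) = (m : K) * γ := rfl
    have hcm : ((m : 𝓞 K) : K) = m := map_natCast (algebraMap (𝓞 K) K) m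
    rw [hgm, hcm, map_mul, Rat.cast_mul, abs_mul, mul_assoc] at hN'
    refine le_of_mul_le_mul_left (by rwa [mul_one]) (a := |((Algebra.norm ℚ (m : K) : ℚ) : ℝ)|) ?_
    rw [abs_pos, Rat.cast_ne_zero, Algebra.norm_ne_zero_iff]
    exact_mod_cast hm
  · rw [Nat.pos_iff_ne_zero, Ne, Ideal.absNorm_eq_zero_iff, ← Ne]
    refine mul_ne_zero ?_ hJ0
    simpa using hg0

/-- If `σ` acts trivially on the integers modulo `s`, where `s ^ 2 = p`, then an element moved by
`σ` has large height. -/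
theorem nfHeight_lower_bound [NumberField K] {p : ℕ} (hp : p ≠ 0) {s : K} (hs : s ^ 2 = p)
    (σ : K →+* K) (hσ : ∀ z : K, IsIntegral ℤ z → IsIntegral ℤ ((z - σ z) / s)) {x : K}
    (hx : σ x ≠ x) :
    Real.log p / 4 - Real.log 2 / 2 ≤ nfHeight K x := by
  have hs0 : s ≠ 0 := by
    rintro rfl
    simp [eq_comm, hp] at hs
  set γ := (x - σ x) / s with hγ
  have hγ0 : γ ≠ 0 := div_ne_zero (sub_ne_zero.mpr hx.symm) hs0
  have hJ : denomIdeal K x * denomIdeal K (σ x) ≤ denomIdeal K γ := by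
    rw [Ideal.mul_le]
    intro a ha b hb
    have h1 := (RingOfIntegers.isIntegral_coe b).mul (hσ _ ha)
    have h2 := (mem_denomIdeal.mp hb).mul (hσ _ (RingOfIntegers.isIntegral_coe a))
    rw [mem_denomIdeal]
    convert! h1.sub h2 using 1
    rw [hγ, map_mul σ, show ((a * b : 𝓞 K) : K) = a * b from map_mul (algebraMap (𝓞 K) K) a b]
    field_simp
    ring
  have hN := one_le_norm_mul_absNorm hγ0
    (mul_ne_zero (denomIdeal_ne_bot x) (denomIdeal_ne_bot (σ x))) hJ
  have hD : (0 : ℝ) < Ideal.absNorm (denomIdeal K x) := by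
    exact_mod_cast absNorm_denomIdeal_pos x
  have hD' : (0 : ℝ) < Ideal.absNorm (denomIdeal K (σ x)) := by
    exact_mod_cast absNorm_denomIdeal_pos (σ x)
  have hw0 (w : InfinitePlace K) : w γ ≠ 0 := (map_ne_zero w).mpr hγ0
  have hlog := Real.log_nonneg hN
  rw [map_mul, Nat.cast_mul, ← Rat.cast_abs, ← InfinitePlace.prod_eq_abs_norm,
    Real.log_mul (Finset.prod_ne_zero_iff.mpr fun w _ => pow_ne_zero _ (hw0 w))
      (mul_pos hD hD').ne', Real.log_mul hD.ne' hD'.ne',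
    Real.log_prod fun w _ => pow_ne_zero _ (hw0 w)] at hlog
  have hw (w : InfinitePlace K) : Real.log (w γ ^ w.mult) ≤
      w.mult * (Real.log 2 - Real.log p / 2) + w.mult * Real.log (max 1 (w x)) +
        w.mult * Real.log (max 1 (w (σ x))) := by
    have hws : Real.log (w s) = Real.log p / 2 := by
      have h := congrArg Real.log (congrArg w hs)
      rw [map_pow, Real.log_pow, ← InfinitePlace.norm_embedding_eq w (p : K), map_natCast,
        Complex.norm_natCast] at h
      push_cast at h
      linarith
    have hle : w (x - σ x) ≤ 2 * max 1 (w x) * max 1 (w (σ x)) := by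
      have h1 : w (x - σ x) ≤ w x + w (σ x) := by
        simp only [← InfinitePlace.norm_embedding_eq, map_sub]
        exact norm_sub_le _ _
      have h2 := le_max_left 1 (w x)
      have h3 := le_max_left 1 (w (σ x))
      have h4 := le_max_right 1 (w x)
      have h5 := le_max_right 1 (w (σ x))
      nlinarith
    have hpos : 0 < w (x - σ x) := InfinitePlace.pos_iff.mpr (sub_ne_zero.mpr hx.symm)
    have hlog' := Real.log_le_log hpos hle
    have hm1 : (0 : ℝ) < max 1 (w x) := by positivity
    have hm2 : (0 : ℝ) < max 1 (w (σ x)) := by positivity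
    rw [Real.log_mul (by positivity) hm2.ne', Real.log_mul two_ne_zero hm1.ne'] at hlog'
    rw [Real.log_pow, hγ, map_div₀, Real.log_div hpos.ne' ((map_ne_zero w).mpr hs0), hws,
      ← mul_add, ← mul_add]
    exact mul_le_mul_of_nonneg_left (by linarith) (Nat.cast_nonneg _)
  have hsum := Finset.sum_le_sum fun w (_ : w ∈ Finset.univ) => hw w
  rw [Finset.sum_add_distrib, Finset.sum_add_distrib, ← Finset.sum_mul, ← Nat.cast_sum,
    InfinitePlace.sum_mult_eq] at hsum
  have hfin : (0 : ℝ) < Module.finrank ℚ K := by exact_mod_cast Module.finrank_pos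
  have hnf (y : K) : (Module.finrank ℚ K : ℝ) * nfHeight K y =
      (∑ w : InfinitePlace K, (w.mult : ℝ) * Real.log (max 1 (w y))) +
        Real.log (Ideal.absNorm (denomIdeal K y)) := by
    rw [nfHeight, mul_inv_cancel_left₀ hfin.ne']
  have hconj := nfHeight_map_le σ x
  have key : 0 ≤ (Module.finrank ℚ K : ℝ) *
      (Real.log 2 - Real.log p / 2 + nfHeight K x + nfHeight K (σ x)) := by
    rw [mul_add, mul_add, hnf, hnf]
    linarith
  have := nonneg_of_mul_nonneg_right key hfin
  linarith

end Height

section Quadratic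

variable {F : IntermediateField ℚ ℂ} {θ : ℂ}

theorem exists_add_mul_of_mem_adjoin_sqrt (hθ : θ ^ 2 ∈ F) {z : ℂ} (hz : z ∈ F⟮θ⟯) :
    ∃ u ∈ F, ∃ v ∈ F, z = u + v * θ := by
  have halg : IsAlgebraic F θ :=
    IsAlgebraic.of_pow two_pos (isAlgebraic_algebraMap (⟨θ ^ 2, hθ⟩ : F))
  rw [← mem_toSubalgebra, adjoin_simple_toSubalgebra_of_isAlgebraic halg] at hz
  induction hz using Algebra.adjoin_induction with
  | mem x hx =>
    rw [Set.mem_singleton_iff] at hx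
    exact ⟨0, zero_mem F, 1, one_mem F, by rw [hx]; ring⟩
  | algebraMap r => exact ⟨r, r.2, 0, zero_mem F, by simp⟩
  | add x y _ _ hx hy =>
    obtain ⟨u, hu, v, hv, rfl⟩ := hx
    obtain ⟨u', hu', v', hv', rfl⟩ := hy
    exact ⟨u + u', add_mem hu hu', v + v', add_mem hv hv', by ring⟩
  | mul x y _ _ hx hy =>
    obtain ⟨u, hu, v, hv, rfl⟩ := hx
    obtain ⟨u', hu', v', hv', rfl⟩ := hy
    exact ⟨u * u' + v * v' * θ ^ 2, add_mem (mul_mem hu hu') (mul_mem (mul_mem hv hv') hθ),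
      u * v' + v * u', add_mem (mul_mem hu hv') (mul_mem hv hu'), by ring⟩

theorem exists_conj_adjoin_sqrt (hθ : θ ^ 2 ∈ F) (hF : θ ∉ F) :
    ∃ σ : F⟮θ⟯ →ₐ[F] F⟮θ⟯,
      σ (AdjoinSimple.gen F θ) = -AdjoinSimple.gen F θ := by
  have hroot : (Polynomial.X ^ 2 - Polynomial.C (⟨θ ^ 2, hθ⟩ : F)).aeval θ = 0 := by
    simp
  have h_int : IsIntegral F θ := ⟨_, Polynomial.monic_X_pow_sub_C _ two_ne_zero, hroot⟩
  have hmin : minpoly F θ = Polynomial.X ^ 2 - Polynomial.C (⟨θ ^ 2, hθ⟩ : F) := by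
    refine (minpoly.eq_of_irreducible_of_monic ?_ hroot
      (Polynomial.monic_X_pow_sub_C _ two_ne_zero)).symm
    refine X_pow_sub_C_irreducible_of_prime Nat.prime_two fun b hb => hF ?_
    have hb' : (b : ℂ) ^ 2 = θ ^ 2 := congrArg (algebraMap F ℂ) hb
    rcases sq_eq_sq_iff_eq_or_eq_neg.mp hb' with h | h
    · exact h ▸ b.2
    · rw [← neg_eq_iff_eq_neg] at h
      exact h ▸ neg_mem b.2
  refine ⟨(adjoin.powerBasis h_int).lift (-AdjoinSimple.gen F θ) ?_, ?_⟩
  · rw [adjoin.powerBasis_gen, minpoly_gen, hmin]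
    apply (algebraMap F⟮θ⟯ ℂ).injective
    simp
  · exact PowerBasis.lift_gen _ _ _

theorem isIntegral_conj_of_isIntegral (hθ : θ ^ 2 ∈ F) (hF : θ ∉ F) {u v : ℂ} (hu : u ∈ F)
    (hv : v ∈ F) (h : IsIntegral ℤ (u + v * θ)) : IsIntegral ℤ (u - v * θ) := by
  obtain ⟨σ, hσ⟩ := exists_conj_adjoin_sqrt hθ hF
  set z : F⟮θ⟯ := algebraMap F F⟮θ⟯ ⟨u, hu⟩ + algebraMap F F⟮θ⟯ ⟨v, hv⟩ * AdjoinSimple.gen F θ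
    with hz
  have hzi : IsIntegral ℤ z := by
    rw [← isIntegral_algebraMap_iff (B := ℂ) (algebraMap F⟮θ⟯ ℂ).injective]
    exact h
  have h1 := (hzi.map (σ : F⟮θ⟯ →+* F⟮θ⟯).toIntAlgHom).map (algebraMap F⟮θ⟯ ℂ).toIntAlgHom
  convert! h1 using 1
  change _ = algebraMap F⟮θ⟯ ℂ (σ z)
  rw [hz, map_add, map_mul, AlgHom.commutes, AlgHom.commutes, hσ]
  simp
  rfl

end Quadratic

/-- The integer `p` is squarefree in the ring of integers of `E`. -/
def IsSquarefreeIn (p : ℕ) (E : IntermediateField ℚ ℂ) : Prop :=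
  ∀ c ∈ E, IsIntegral ℤ ((p : ℂ) * c ^ 2) → IsIntegral ℤ c

theorem IsSquarefreeIn.mono {p : ℕ} {E F : IntermediateField ℚ ℂ} (h : IsSquarefreeIn p F)
    (hEF : E ≤ F) : IsSquarefreeIn p E := fun c hc => h c (hEF hc)

theorem isIntegral_of_coprime {m n : ℕ} (h : m.Coprime n) {c : ℂ}
    (hm : IsIntegral ℤ ((m : ℂ) * c)) (hn : IsIntegral ℤ ((n : ℂ) * c)) : IsIntegral ℤ c := by
  have hb : ((m : ℂ) * (m.gcdA n : ℤ) + (n : ℂ) * (m.gcdB n : ℤ)) = 1 := by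
    have := Nat.gcd_eq_gcd_ab m n
    rw [h.gcd_eq_one] at this
    exact_mod_cast this.symm
  have h1 := (hm.mul (isIntegral_algebraMap (R := ℤ) (A := ℂ) (x := m.gcdA n))).add
    (hn.mul (isIntegral_algebraMap (R := ℤ) (A := ℂ) (x := m.gcdB n)))
  convert! h1 using 1
  simp only [algebraMap_int_eq, eq_intCast]
  linear_combination -c * hb

theorem isIntegral_natCast_complex (n : ℕ) : IsIntegral ℤ (n : ℂ) := by
  simpa using isIntegral_algebraMap (R := ℤ) (A := ℂ) (x := (n : ℤ))

theorem isIntegral_natCast_mul_of_sq {p : ℕ} {c : ℂ} (h : IsIntegral ℤ ((p : ℂ) * c ^ 2)) :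
    IsIntegral ℤ ((p : ℂ) * c) := by
  refine IsIntegral.of_pow two_pos ?_
  convert! (isIntegral_natCast_complex p).mul h using 1
  ring

theorem isSquarefreeIn_bot {p : ℕ} (hp : p.Prime) : IsSquarefreeIn p ⊥ := by
  intro c hc h
  obtain ⟨q, rfl⟩ := mem_bot.mp hc
  have hpc := isIntegral_natCast_mul_of_sq h
  have aux (t : ℚ) (ht : IsIntegral ℤ (t : ℂ)) : ∃ k : ℤ, (k : ℚ) = t := by
    have : IsIntegral ℤ t := by
      rw [← isIntegral_algebraMap_iff (B := ℂ) (algebraMap ℚ ℂ).injective]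
      exact ht
    exact IsIntegrallyClosed.isIntegral_iff.mp this
  obtain ⟨k, hk⟩ := aux (p * q ^ 2) (by simpa using h)
  obtain ⟨m, hm⟩ := aux (p * q) (by simpa using hpc)
  have hmk : m ^ 2 = p * k := by
    have : (m : ℚ) ^ 2 = p * k := by rw [hk, hm]; ring
    exact_mod_cast this
  obtain ⟨n, rfl⟩ := (Nat.prime_iff_prime_int.mp hp).dvd_of_dvd_pow (Dvd.intro _ hmk.symm)
  have hq : q = n := by
    have hp0 : (p : ℚ) ≠ 0 := by exact_mod_cast hp.ne_zero
    apply mul_left_cancel₀ hp0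
    rw [← hm]
    push_cast
    ring
  rw [hq]
  simpa using isIntegral_algebraMap (R := ℤ) (A := ℂ) (x := n)

theorem IsSquarefreeIn.adjoin_sqrt {p m : ℕ} {F : IntermediateField ℚ ℂ} {θ w : ℂ}
    (h : IsSquarefreeIn p F) (hθ : θ ^ 2 ∈ F) (hθi : IsIntegral ℤ θ) (hw : IsIntegral ℤ w)
    (hm : θ * w = m) (hpm : p.Coprime (2 * m)) :
    IsSquarefreeIn p (F⟮θ⟯.restrictScalars ℚ) := by
  intro c hc h_int
  obtain ⟨u, hu, v, hv, rfl⟩ := exists_add_mul_of_mem_adjoin_sqrt hθ hc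
  by_cases hF : θ ∈ F
  · exact h _ (add_mem hu (mul_mem hv hF)) h_int
  have h2 : (2 : ℂ) ∈ F := ofNat_mem F 2
  have hp : (p : ℂ) ∈ F := _root_.natCast_mem F p
  have h_int' : IsIntegral ℤ ((p : ℂ) * (u - v * θ) ^ 2) := by
    have := isIntegral_conj_of_isIntegral hθ hF (u := p * (u ^ 2 + v ^ 2 * θ ^ 2))
      (v := p * (2 * u * v))
      (mul_mem hp (add_mem (pow_mem hu 2) (mul_mem (pow_mem hv 2) hθ)))
      (mul_mem hp (mul_mem (mul_mem h2 hu) hv)) (by convert! h_int using 1; ring)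
    convert! this using 1
    ring
  have hprod : IsIntegral ℤ ((p : ℂ) * (u + v * θ) * (u - v * θ)) := by
    refine IsIntegral.of_pow two_pos ?_
    convert! h_int.mul h_int' using 1
    ring
  have htwo : IsIntegral ℤ (2 : ℂ) := by exact_mod_cast isIntegral_natCast_complex 2
  have hu2 : IsIntegral ℤ (2 * u) := by
    refine h _ (mul_mem h2 hu) ?_
    convert! (h_int.add h_int').add (htwo.mul hprod) using 1
    ring
  have hv2 : IsIntegral ℤ (2 * v * θ ^ 2) := by
    refine h _ (mul_mem (mul_mem h2 hv) hθ) ?_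
    convert! (hθi.pow 2).mul ((h_int.add h_int').sub (htwo.mul hprod)) using 1
    ring
  refine isIntegral_of_coprime hpm (isIntegral_natCast_mul_of_sq h_int) ?_
  convert! ((isIntegral_natCast_complex m).mul hu2).add (hv2.mul hw) using 1
  push_cast
  linear_combination -(2 * v * θ) * hm

theorem IsSquarefreeIn.sqrt_notMem {p : ℕ} (hp : p.Prime) {F : IntermediateField ℚ ℂ}
    (h : IsSquarefreeIn p F) {s : ℂ} (hs : s ^ 2 = p) : s ∉ F := by
  intro hsF
  have hp0 : (p : ℂ) ≠ 0 := by exact_mod_cast hp.ne_zero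
  have hs0 : s ≠ 0 := by
    rintro rfl
    simp [eq_comm, hp.ne_zero] at hs
  have h1 : IsIntegral ℤ s⁻¹ := by
    refine h _ (inv_mem hsF) ?_
    rw [inv_pow, hs, mul_inv_cancel₀ hp0]
    exact isIntegral_one
  have h2 : IsIntegral ℤ ((p : ℚ)⁻¹) := by
    rw [← isIntegral_algebraMap_iff (B := ℂ) (algebraMap ℚ ℂ).injective]
    have := h1.pow 2
    rw [inv_pow, hs] at this
    simpa using this
  obtain ⟨k, hk⟩ := IsIntegrallyClosed.isIntegral_iff.mp h2
  have hpk : (p : ℤ) * k = 1 := by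
    have hp0 : (p : ℚ) ≠ 0 := by exact_mod_cast hp.ne_zero
    have : (p : ℚ) * k = 1 := by
      rw [show (k : ℚ) = (p : ℚ)⁻¹ from hk, mul_inv_cancel₀ hp0]
    exact_mod_cast this
  exact (Nat.prime_iff_prime_int.mp hp).not_isUnit (IsUnit.of_mul_eq_one _ hpk)

theorem nfHeight_le_algHeight {M : Type*} [Field M] [NumberField M] {x : ℂ}
    (hx : IsIntegral ℚ x) (f : ℚ⟮x⟯ →+* M) :
    nfHeight M (f (AdjoinSimple.gen ℚ x)) ≤ algHeight x := by
  rw [algHeight, dif_pos hx]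
  have : FiniteDimensional ℚ ℚ⟮x⟯ := adjoin.finiteDimensional hx
  have : NumberField ℚ⟮x⟯ := { }
  exact nfHeight_map_le f _

/-- Let `p` be squarefree in `F`. Elements of `F(√p)` outside `F` have height bounded below
independently of `F`. -/
theorem algHeight_lower_bound {p : ℕ} (hp : p.Prime) {F : IntermediateField ℚ ℂ}
    (hF : IsSquarefreeIn p F) (halg : F ≤ Qbar) {s : ℂ} (hs : s ^ 2 = p) {x : ℂ}
    (hx : x ∈ F⟮s⟯) (hxF : x ∉ F) :
    Real.log p / 4 - Real.log 2 / 2 ≤ algHeight x := by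
  have hsF : s ^ 2 ∈ F := hs ▸ _root_.natCast_mem F p
  obtain ⟨a, ha, b, hb, rfl⟩ := exists_add_mul_of_mem_adjoin_sqrt hsF hx
  have haQ : IsIntegral ℚ a := (mem_algebraicClosure_iff.mp (halg ha)).isIntegral
  have hbQ : IsIntegral ℚ b := (mem_algebraicClosure_iff.mp (halg hb)).isIntegral
  have hsZ : IsIntegral ℤ s :=
    IsIntegral.of_pow two_pos (hs ▸ isIntegral_natCast_complex p)
  have hsQ : IsIntegral ℚ s := hsZ.tower_top
  set E : IntermediateField ℚ ℂ := adjoin ℚ {a, b}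
  have haE : a ∈ E := subset_adjoin ℚ _ (by simp)
  have hbE : b ∈ E := subset_adjoin ℚ _ (by simp)
  have hEF : E ≤ F := adjoin_le_iff.mpr (by rintro y (rfl | rfl) <;> assumption)
  have hEsq := hF.mono hEF
  have hsE : s ^ 2 ∈ E := hs ▸ _root_.natCast_mem E p
  have hsnE : s ∉ E := hEsq.sqrt_notMem hp hs
  have : FiniteDimensional ℚ E := by
    refine finiteDimensional_adjoin fun y hy => ?_
    rcases hy with rfl | rfl <;> assumption
  have : FiniteDimensional E E⟮s⟯ := adjoin.finiteDimensional hsQ.tower_top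
  have : FiniteDimensional ℚ E⟮s⟯ := FiniteDimensional.trans ℚ E E⟮s⟯
  have : NumberField E⟮s⟯ := { to_finiteDimensional := by convert! this }
  obtain ⟨σ, hσ⟩ := exists_conj_adjoin_sqrt hsE hsnE
  have hs0 : s ≠ 0 := by
    rintro rfl
    exact hsnE (zero_mem E)
  have hσ' {u v : ℂ} (hu : u ∈ E) (hv : v ∈ E) {z : E⟮s⟯} (hz : (z : ℂ) = u + v * s) :
      ((σ z : E⟮s⟯) : ℂ) = u - v * s := by
    have : z = algebraMap E E⟮s⟯ ⟨u, hu⟩ + algebraMap E E⟮s⟯ ⟨v, hv⟩ * AdjoinSimple.gen E s :=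
      Subtype.ext hz
    rw [this, map_add, map_mul, AlgHom.commutes, AlgHom.commutes, hσ]
    change u + v * -s = _
    ring
  have hxM : a + b * s ∈ E⟮s⟯ := add_mem (IntermediateField.algebraMap_mem E⟮s⟯ ⟨a, haE⟩)
    (mul_mem (IntermediateField.algebraMap_mem E⟮s⟯ ⟨b, hbE⟩) (mem_adjoin_simple_self E s))
  have hle : ℚ⟮a + b * s⟯ ≤ E⟮s⟯.restrictScalars ℚ := adjoin_simple_le_iff.mpr hxM
  have hxQ : IsIntegral ℚ (a + b * s) := haQ.add (hbQ.mul hsQ)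
  refine le_trans ?_ (nfHeight_le_algHeight (M := E⟮s⟯) hxQ (inclusion hle).toRingHom)
  refine nfHeight_lower_bound hp.ne_zero (s := AdjoinSimple.gen E s) (Subtype.ext hs)
    (σ : E⟮s⟯ →+* E⟮s⟯) ?_ ?_
  · intro z hz
    obtain ⟨u, hu, v, hv, huv⟩ := exists_add_mul_of_mem_adjoin_sqrt hsE z.2
    rw [← isIntegral_algebraMap_iff (B := ℂ) (algebraMap E⟮s⟯ ℂ).injective] at hz ⊢
    have hcoe : algebraMap E⟮s⟯ ℂ ((z - σ z) / AdjoinSimple.gen E s) = 2 * v := by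
      change ((z : ℂ) - (σ z : E⟮s⟯)) / s = 2 * v
      rw [hσ' hu hv huv, huv]
      field_simp
      ring
    change IsIntegral ℤ (algebraMap E⟮s⟯ ℂ ((z - σ z) / AdjoinSimple.gen E s))
    rw [hcoe]
    refine hEsq _ (mul_mem (ofNat_mem E 2) hv) ?_
    change IsIntegral ℤ (z : ℂ) at hz
    rw [huv] at hz
    convert! (hz.sub (isIntegral_conj_of_isIntegral hsE hsnE hu hv hz)).pow 2 using 1
    linear_combination (-4 * v ^ 2) * hs
  · intro h
    have h' : (σ ⟨a + b * s, hxM⟩ : ℂ) = a + b * s := congrArg (algebraMap E⟮s⟯ ℂ) h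
    rw [hσ' haE hbE rfl] at h'
    have hb0 : b = 0 := by
      have : b * s = 0 := by linear_combination (-1 / 2 : ℂ) * h'
      exact (mul_eq_zero.mp this).resolve_right hs0
    apply hxF
    simpa [hb0] using ha

theorem nfHeight_of_pow_eq_two {K : Type*} [Field K] [NumberField K] {k : ℕ} (hk : k ≠ 0)
    {y : K} (hy : y ^ k = 2) : nfHeight K y = Real.log 2 / k := by
  have h_int : IsIntegral ℤ y := by
    refine IsIntegral.of_pow (Nat.pos_of_ne_zero hk) (hy ▸ ?_)
    simpa using isIntegral_algebraMap (R := ℤ) (A := K) (x := 2)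
  have htop : denomIdeal K y = ⊤ := by
    rw [Ideal.eq_top_iff_one, mem_denomIdeal]
    simpa using h_int
  have hk' : (k : ℝ) ≠ 0 := by exact_mod_cast hk
  have hlog (w : InfinitePlace K) : Real.log (max 1 (w y)) = Real.log 2 / k := by
    have h : w y ^ k = 2 := by
      rw [← map_pow, hy, ← InfinitePlace.norm_embedding_eq, map_ofNat]
      simp
    have h1 : 1 ≤ w y := by
      by_contra! hlt
      have := pow_le_one₀ (n := k) (apply_nonneg w y) hlt.le
      linarith
    rw [max_eq_right h1, ← h, Real.log_pow]
    field_simp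
  have hfin : (Module.finrank ℚ K : ℝ) ≠ 0 := by exact_mod_cast Module.finrank_pos.ne'
  simp_rw [nfHeight, hlog, htop, Ideal.absNorm_top, ← Finset.sum_mul, ← Nat.cast_sum,
    InfinitePlace.sum_mult_eq]
  simp [hfin]

theorem algHeight_of_pow_eq_two {k : ℕ} (hk : k ≠ 0) {x : ℂ} (hx : x ^ k = 2) :
    algHeight x = Real.log 2 / k := by
  have h_int : IsIntegral ℚ x := by
    refine IsIntegral.of_pow (Nat.pos_of_ne_zero hk) (hx ▸ ?_)
    simpa using isIntegral_algebraMap (R := ℚ) (A := ℂ) (x := 2)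
  rw [algHeight, dif_pos h_int]
  have : FiniteDimensional ℚ ℚ⟮x⟯ := adjoin.finiteDimensional h_int
  have : NumberField ℚ⟮x⟯ := { }
  exact nfHeight_of_pow_eq_two hk (Subtype.ext hx)

/-- The iterated positive square roots of `2`, that is `2 ^ (1 / 2 ^ n)`. -/
def sqrtIter : ℕ → ℝ
  | 0 => 2
  | n + 1 => √(sqrtIter n)

theorem sqrtIter_nonneg (n : ℕ) : 0 ≤ sqrtIter n := by
  cases n with
  | zero => exact zero_le_two
  | succ n => exact Real.sqrt_nonneg _

theorem sqrtIter_succ_sq (n : ℕ) : (sqrtIter (n + 1) : ℂ) ^ 2 = sqrtIter n := by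
  exact_mod_cast Real.sq_sqrt (sqrtIter_nonneg n)

theorem sqrtIter_pow (n : ℕ) : (sqrtIter n : ℂ) ^ 2 ^ n = 2 := by
  induction n with
  | zero => simp [sqrtIter]
  | succ n ih => rw [pow_succ', pow_mul, sqrtIter_succ_sq, ih]

theorem isIntegral_sqrtIter (n : ℕ) : IsIntegral ℤ (sqrtIter n : ℂ) := by
  refine IsIntegral.of_pow (n := 2 ^ n) (by positivity) (sqrtIter_pow n ▸ ?_)
  exact_mod_cast isIntegral_natCast_complex 2

/-- The field generated by all iterated square roots of `2`. -/
def baseField : IntermediateField ℚ ℂ := ⨆ n, ℚ⟮(sqrtIter n : ℂ)⟯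

theorem monotone_adjoin_sqrtIter : Monotone fun n => ℚ⟮(sqrtIter n : ℂ)⟯ := by
  refine monotone_nat_of_le_succ fun n => ?_
  rw [adjoin_simple_le_iff, ← sqrtIter_succ_sq n]
  exact pow_mem (mem_adjoin_simple_self ℚ (sqrtIter (n + 1) : ℂ)) 2

theorem mem_baseField {x : ℂ} : x ∈ baseField ↔ ∃ n, x ∈ ℚ⟮(sqrtIter n : ℂ)⟯ := by
  rw [baseField, ← SetLike.mem_coe, coe_iSup_of_directed monotone_adjoin_sqrtIter.directed_le]
  simp

theorem sqrtIter_mem_baseField (n : ℕ) : (sqrtIter n : ℂ) ∈ baseField :=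
  mem_baseField.mpr ⟨n, mem_adjoin_simple_self ℚ (sqrtIter n : ℂ)⟩

theorem baseField_le_Qbar : baseField ≤ Qbar :=
  iSup_le fun n => adjoin_simple_le_iff.mpr
    (mem_algebraicClosure_iff.mpr ((isIntegral_sqrtIter n).tower_top (A := ℚ)).isAlgebraic)

theorem isSquarefreeIn_baseField {p : ℕ} (hp : p.Prime) (hp2 : p ≠ 2) :
    IsSquarefreeIn p baseField := by
  have hchain (n : ℕ) : IsSquarefreeIn p ℚ⟮(sqrtIter n : ℂ)⟯ := by
    induction n with
    | zero =>
      refine (isSquarefreeIn_bot hp).mono (adjoin_simple_le_iff.mpr ?_)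
      simp [sqrtIter]
    | succ n ih =>
      refine (ih.adjoin_sqrt (θ := sqrtIter (n + 1)) (w := sqrtIter (n + 1) ^ (2 ^ (n + 1) - 1))
        (m := 2) ?_ (isIntegral_sqrtIter _) ((isIntegral_sqrtIter _).pow _) ?_ ?_).mono ?_
      · rw [sqrtIter_succ_sq]
        exact mem_adjoin_simple_self ℚ (sqrtIter n : ℂ)
      · rw [mul_pow_sub_one (by positivity), sqrtIter_pow, Nat.cast_ofNat]
      · exact Nat.Coprime.mul_right ((Nat.coprime_primes hp Nat.prime_two).mpr hp2)
          ((Nat.coprime_primes hp Nat.prime_two).mpr hp2)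
      · exact adjoin_simple_le_iff.mpr
          (mem_adjoin_simple_self ℚ⟮(sqrtIter n : ℂ)⟯ (sqrtIter (n + 1) : ℂ))
  intro c hc
  obtain ⟨n, hn⟩ := mem_baseField.mp hc
  exact hchain n c hn

theorem not_finiteDimensional_baseField : ¬ FiniteDimensional ℚ baseField := by
  intro hfin
  have : NumberField baseField := { }
  obtain ⟨n, hn⟩ : ∃ n : ℕ, Module.finrank ℚ baseField < 2 ^ n :=
    ⟨_, Nat.lt_two_pow_self⟩
  set r : baseField := ⟨sqrtIter n, sqrtIter_mem_baseField n⟩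
  have hr : r ^ 2 ^ n = algebraMap ℚ baseField 2 := by
    rw [map_ofNat]
    exact Subtype.ext (sqrtIter_pow n)
  have hri : IsIntegral ℤ r := by
    rw [← isIntegral_algebraMap_iff (B := ℂ) (algebraMap baseField ℂ).injective]
    exact isIntegral_sqrtIter n
  have hnorm := congrArg (Algebra.norm ℚ) hr
  rw [map_pow, Algebra.norm_algebraMap] at hnorm
  obtain ⟨k, hk⟩ := IsIntegrallyClosed.isIntegral_iff.mp
    (Algebra.isIntegral_norm ℚ hri)
  rw [← hk] at hnorm
  have hk2 : k.natAbs ^ 2 ^ n = 2 ^ Module.finrank ℚ baseField := by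
    have h : k ^ 2 ^ n = 2 ^ Module.finrank ℚ baseField := by
      have h' : (k : ℚ) ^ 2 ^ n = 2 ^ Module.finrank ℚ baseField := hnorm
      exact_mod_cast h'
    rw [← Int.natAbs_pow, h, Int.natAbs_pow]
    rfl
  have h1 : 1 < 2 ^ Module.finrank ℚ baseField :=
    Nat.one_lt_two_pow Module.finrank_pos.ne'
  have h2 : 2 ≤ k.natAbs := by
    by_contra! hlt
    have := Nat.pow_le_one_iff (n := 2 ^ n) (by positivity) |>.mpr (Nat.le_of_lt_succ hlt)
    omega
  have h3 := Nat.pow_le_pow_left h2 (2 ^ n)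
  have h4 := Nat.pow_lt_pow_right one_lt_two hn
  omega

theorem not_hasBogomolovProperty_baseField : ¬ HasBogomolovProperty baseField := by
  rintro ⟨ε, hε, h⟩
  obtain ⟨n, hn⟩ : ∃ n : ℕ, Real.log 2 / ε < 2 ^ n := pow_unbounded_of_one_lt _ one_lt_two
  have hlog : 0 < Real.log 2 := Real.log_pos one_lt_two
  have hheight := algHeight_of_pow_eq_two (k := 2 ^ n) (by positivity) (sqrtIter_pow n)
  refine h _ (sqrtIter_mem_baseField n) ?_ ⟨?_, ?_⟩
  · intro h0
    have := sqrtIter_pow n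
    rw [h0, zero_pow (by positivity)] at this
    norm_num at this
  · rw [hheight]
    positivity
  · rw [hheight, Nat.cast_pow, Nat.cast_ofNat, div_lt_comm₀ (by positivity) hε]
    exact hn

/-- The increasing sequence of the primes that are at least `5`. -/
def primeSeq (n : ℕ) : ℕ := Nat.nth Nat.Prime (n + 2)

theorem prime_primeSeq (n : ℕ) : (primeSeq n).Prime := Nat.prime_nth_prime _

theorem primeSeq_injective : Function.Injective primeSeq := fun m n h => by
  simpa using Nat.nth_injective Nat.infinite_setOfPred_prime h

theorem five_le_primeSeq (n : ℕ) : 5 ≤ primeSeq n := by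
  rw [← Nat.nth_prime_two_eq_five]
  exact Nat.nth_monotone Nat.infinite_setOfPred_prime (by omega)

/-- Square roots of the primes `primeSeq n`. -/
def sqrtPrime (n : ℕ) : ℂ := (√(primeSeq n : ℝ) : ℝ)

theorem sqrtPrime_sq (n : ℕ) : sqrtPrime n ^ 2 = primeSeq n := by
  rw [sqrtPrime]
  exact_mod_cast Real.sq_sqrt (Nat.cast_nonneg _)

theorem isIntegral_sqrtPrime (n : ℕ) : IsIntegral ℤ (sqrtPrime n) :=
  IsIntegral.of_pow two_pos (sqrtPrime_sq n ▸ isIntegral_natCast_complex _)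

/-- The tower over `baseField` obtained by successively adjoining square roots of primes. -/
def sqrtTower : ℕ → IntermediateField ℚ ℂ
  | 0 => baseField
  | n + 1 => (sqrtTower n)⟮sqrtPrime n⟯.restrictScalars ℚ

theorem sqrtTower_le_succ (n : ℕ) : sqrtTower n ≤ sqrtTower (n + 1) := fun x hx =>
  IntermediateField.algebraMap_mem (sqrtTower n)⟮sqrtPrime n⟯ ⟨x, hx⟩

theorem monotone_sqrtTower : Monotone sqrtTower := monotone_nat_of_le_succ sqrtTower_le_succ

theorem sqrtPrime_mem_sqrtTower_succ (n : ℕ) : sqrtPrime n ∈ sqrtTower (n + 1) :=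
  mem_adjoin_simple_self (sqrtTower n) (sqrtPrime n)

theorem sqrtPrime_sq_mem (E : IntermediateField ℚ ℂ) (n : ℕ) : sqrtPrime n ^ 2 ∈ E :=
  sqrtPrime_sq n ▸ _root_.natCast_mem E _

theorem sqrtTower_le_Qbar (n : ℕ) : sqrtTower n ≤ Qbar := by
  induction n with
  | zero => exact baseField_le_Qbar
  | succ n ih =>
    intro x hx
    obtain ⟨u, hu, v, hv, rfl⟩ :=
      exists_add_mul_of_mem_adjoin_sqrt (sqrtPrime_sq_mem (sqrtTower n) n) hx
    exact add_mem (ih hu) (mul_mem (ih hv) (mem_algebraicClosure_iff.mpr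
      ((isIntegral_sqrtPrime n).tower_top (A := ℚ)).isAlgebraic))

theorem isSquarefreeIn_sqrtTower {n m : ℕ} (h : m ≤ n) :
    IsSquarefreeIn (primeSeq n) (sqrtTower m) := by
  have h5 := five_le_primeSeq n
  have h2 : primeSeq n ≠ 2 := by omega
  induction m with
  | zero => exact isSquarefreeIn_baseField (prime_primeSeq n) h2
  | succ m ih =>
    refine (ih (by omega)).adjoin_sqrt (w := sqrtPrime m) (m := primeSeq m)
      (sqrtPrime_sq_mem _ m) (isIntegral_sqrtPrime m) (isIntegral_sqrtPrime m) ?_ ?_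
    · rw [← sq, sqrtPrime_sq]
    · refine Nat.Coprime.mul_right ((Nat.coprime_primes (prime_primeSeq n) Nat.prime_two).mpr h2)
        ((Nat.coprime_primes (prime_primeSeq n) (prime_primeSeq m)).mpr ?_)
      intro heq
      have := primeSeq_injective heq
      omega

theorem sqrtPrime_notMem_sqrtTower (n : ℕ) : sqrtPrime n ∉ sqrtTower n :=
  (isSquarefreeIn_sqrtTower le_rfl).sqrt_notMem (prime_primeSeq n) (sqrtPrime_sq n)

/-- The union of the tower `sqrtTower`. -/
def topField : IntermediateField ℚ ℂ := ⨆ n, sqrtTower n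

theorem mem_topField {x : ℂ} : x ∈ topField ↔ ∃ n, x ∈ sqrtTower n := by
  rw [topField, ← SetLike.mem_coe, coe_iSup_of_directed monotone_sqrtTower.directed_le]
  simp

theorem baseField_le_topField : baseField ≤ topField := le_iSup sqrtTower 0

theorem algHeight_lower_bound_sqrtTower {n : ℕ} {x : ℂ} (hx : x ∈ sqrtTower n)
    (hxK : x ∉ baseField) : Real.log 5 / 4 - Real.log 2 / 2 ≤ algHeight x := by
  induction n with
  | zero => exact absurd hx hxK
  | succ n ih =>
    by_cases hxn : x ∈ sqrtTower n
    · exact ih hxn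
    · refine le_trans ?_ (algHeight_lower_bound (prime_primeSeq n)
        (isSquarefreeIn_sqrtTower le_rfl) (sqrtTower_le_Qbar n) (sqrtPrime_sq n) hx hxn)
      have : Real.log 5 ≤ Real.log (primeSeq n) :=
        Real.log_le_log (by norm_num) (by exact_mod_cast five_le_primeSeq n)
      linarith

theorem isBogomolovExtension_baseField_topField :
    IsBogomolovExtension baseField topField := by
  refine ⟨Real.log 5 / 4 - Real.log 2 / 2, ?_, fun x hx _ _ hlt => ?_⟩
  · have h : Real.log 4 < Real.log 5 := Real.log_lt_log (by norm_num) (by norm_num)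
    rw [show (4 : ℝ) = 2 ^ 2 by norm_num, Real.log_pow] at h
    push_cast at h
    linarith
  · by_contra hxK
    obtain ⟨n, hn⟩ := mem_topField.mp hx
    exact absurd hlt (not_lt.mpr (algHeight_lower_bound_sqrtTower hn hxK))

theorem not_finiteDimensional_topField :
    ¬ FiniteDimensional baseField (extendScalars baseField_le_topField) := by
  intro hfin
  have h0 (n : ℕ) : baseField ≤ sqrtTower n := monotone_sqrtTower (Nat.zero_le n)
  let f : ℕ →o Submodule baseField (extendScalars baseField_le_topField) :=
    { toFun := fun n => (extendScalars (h0 n)).toSubalgebra.toSubmodule.comap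
        (extendScalars baseField_le_topField).val.toLinearMap
      monotone' := fun m n hmn x hx => monotone_sqrtTower hmn hx }
  obtain ⟨n, hn⟩ := monotone_stabilizes_iff_noetherian.mpr inferInstance f
  have hmem : (⟨sqrtPrime n, mem_topField.mpr ⟨_, sqrtPrime_mem_sqrtTower_succ n⟩⟩ :
      extendScalars baseField_le_topField) ∈ f (n + 1) := sqrtPrime_mem_sqrtTower_succ n
  rw [← hn (n + 1) n.le_succ] at hmem
  exact sqrtPrime_notMem_sqrtTower n hmem

end RelBogomolov

/-- There exist `ℚ ⊆ K ⊆ L ⊆ ℚ̄` with `K/ℚ` infinite, `K` failing (B), and `L/K` an infinite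
extension which is Bogomolov. -/
theorem exists_infinite_bogomolovExtension :
    ∃ (K L : IntermediateField ℚ ℂ) (hKL : K ≤ L), L ≤ Qbar ∧
      ¬ FiniteDimensional ℚ ↥K ∧ ¬ HasBogomolovProperty K ∧
      ¬ FiniteDimensional ↥K ↥(extendScalars hKL) ∧
      IsBogomolovExtension K L :=
  ⟨baseField, topField, baseField_le_topField, iSup_le sqrtTower_le_Qbar,
    not_finiteDimensional_baseField, not_hasBogomolovProperty_baseField,
    not_finiteDimensional_topField, isBogomolovExtension_baseField_topField⟩
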